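/- arXiv:1905.01166 — 2 statements merged into one kernel-verified Lean document; each statement's English description precedes it below -/
import Mathlib

section
/- Let B ∈ ℝ^(d×d) be invertible, v uniformly distributed on [0,1]^d, and f : ℝ^d → ℝ continuous with compact support. Then E|Q_B^v(f) − ∫_{ℝ^d} f(x)dx|² = ∑_{m∈ℤ^d, m≠0} |ℱf(Bm)|², where Q_B^v(f) = |det B|^(−1) ∑_{m∈ℤ^d} f(B^(−⊤)(m+v)) and ℱf is the Fourier transform of f. -/
open Matrix MeasureTheory

/-- The Fourier transform `ℱf(y) = ∫ f(x) e^{-2πi⟨x,y⟩} dx` on `ℝ^d`. -/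
noncomputable def lfourier (d : ℕ) (f : (Fin d → ℝ) → ℝ) (y : Fin d → ℝ) : ℂ :=
  ∫ x : Fin d → ℝ,
    (f x : ℂ) * Complex.exp (-2 * (Real.pi : ℂ) * Complex.I * ((∑ i, x i * y i : ℝ) : ℂ))

/-- The shifted lattice rule `Q_B^v(f) = |det B|⁻¹ ∑_{m ∈ ℤ^d} f(B^{-⊤}(m+v))`. -/
noncomputable def frolovQ (d : ℕ) (B : Matrix (Fin d) (Fin d) ℝ) (v : Fin d → ℝ)
    (f : (Fin d → ℝ) → ℝ) : ℝ :=
  |B.det|⁻¹ * ∑' m : Fin d → ℤ, f ((B⁻¹)ᵀ.mulVec ((fun i => (m i : ℝ)) + v))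

namespace UnitAddTorus

/-- The probability measure on `ℝ / ℤ`, as used for multivariate Fourier series. -/
noncomputable local instance : MeasureSpace UnitAddCircle := ⟨AddCircle.haarAddCircle⟩

local instance : IsProbabilityMeasure (volume : Measure UnitAddCircle) :=
  inferInstanceAs (IsProbabilityMeasure AddCircle.haarAddCircle)

/-- **Parseval's identity** on the half-open unit cube. -/
theorem hasSum_sq_norm_integral_mFourier_unitCube {d : ℕ} (G : (Fin d → ℝ) → ℂ)
    (hG : Continuous G) :
    HasSum (fun n : Fin d → ℤ => ‖∫ x in {x : Fin d → ℝ | ∀ i, x i ∈ Set.Ioc (0 : ℝ) 1},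
        mFourier (-n) (fun i => (x i : UnitAddCircle)) * G x‖ ^ 2)
      (∫ x in {x : Fin d → ℝ | ∀ i, x i ∈ Set.Ioc (0 : ℝ) 1}, ‖G x‖ ^ 2) := by
  have hbox : MeasurableSet {x : Fin d → ℝ | ∀ i, x i ∈ Set.Ioc (0 : ℝ) 1} :=
    MeasurableSet.univ_pi' fun i => measurableSet_Ioc
  set F : UnitAddTorus (Fin d) → ℂ :=
    fun t => G (measurableEquivPiIoc (fun _ => 0) t).1 with hF
  have hFx : ∀ x ∈ {x : Fin d → ℝ | ∀ i, x i ∈ Set.Ioc (0 : ℝ) 1},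
      F (fun i => (x i : UnitAddCircle)) = G x := by
    intro x hx
    have h := (measurableEquivPiIoc (fun _ : Fin d => (0 : ℝ))).apply_symm_apply
      ⟨x, fun i => by simpa using hx i⟩
    rw [coe_symm_measurableEquivPiIoc_apply] at h
    simp only [hF]
    rw [h]
  have hFmeas : Measurable F :=
    hG.measurable.comp (measurable_subtype_coe.comp (MeasurableEquiv.measurable _))
  obtain ⟨C, hC⟩ := (isCompact_univ_pi fun _ : Fin d => isCompact_Icc (a := (0 : ℝ)) (b := 1)
    ).exists_bound_of_continuousOn hG.continuousOn
  have hFL : MemLp F 2 volume := by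
    refine MemLp.of_bound hFmeas.aestronglyMeasurable C (Filter.Eventually.of_forall fun t => ?_)
    refine hC _ fun i _ => ?_
    have := (measurableEquivPiIoc (fun _ => 0) t).2 i
    exact ⟨this.1.le, by simpa using this.2⟩
  have key := hasSum_sq_mFourierCoeff hFL.toLp
  have h1 : ∫ t, ‖hFL.toLp F t‖ ^ 2
      = ∫ x in {x : Fin d → ℝ | ∀ i, x i ∈ Set.Ioc (0 : ℝ) 1}, ‖G x‖ ^ 2 := by
    rw [integral_congr_ae (g := fun t => ‖F t‖ ^ 2)
      (hFL.coeFn_toLp.mono fun t ht => by simp only [ht]), integral_preimage _ 0]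
    simp only [Pi.zero_apply, zero_add]
    exact setIntegral_congr_fun hbox fun x hx => by simp only [hFx x hx]
  have h2 : ∀ n, mFourierCoeff (hFL.toLp F) n
      = ∫ x in {x : Fin d → ℝ | ∀ i, x i ∈ Set.Ioc (0 : ℝ) 1},
        mFourier (-n) (fun i => (x i : UnitAddCircle)) * G x := fun n => by
    have : mFourierCoeff (hFL.toLp F) n = mFourierCoeff F n :=
      integral_congr_ae (hFL.coeFn_toLp.mono fun t ht => by simp only [ht])
    rw [this, mFourierCoeff_eq_integral _ _ 0]
    simp only [Pi.zero_apply, zero_add]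
    exact setIntegral_congr_fun hbox fun x hx => by simp only [hFx x hx, smul_eq_mul]
  simpa only [h1, h2] using key

end UnitAddTorus

open UnitAddTorus in
theorem mFourier_neg_coe {d : ℕ} (n : Fin d → ℤ) (x : Fin d → ℝ) :
    mFourier (-n) (fun i => (x i : UnitAddCircle))
      = Complex.exp (-2 * (Real.pi : ℂ) * Complex.I * ((∑ i, x i * n i : ℝ) : ℂ)) := by
  simp only [mFourier, ContinuousMap.coe_mk, fourier_coe_apply, ← Complex.exp_sum]
  congr 1
  push_cast
  rw [Finset.mul_sum]
  refine Finset.sum_congr rfl fun i _ => ?_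
  simp
  ring

/-- The integral over `ℝ^d` is the sum of the integrals over integer translates of the
half-open unit cube. -/
theorem hasSum_integral_unitCube_translates {d : ℕ} (h : (Fin d → ℝ) → ℂ) (hh : Integrable h) :
    HasSum (fun m : Fin d → ℤ => ∫ x in {x : Fin d → ℝ | ∀ i, x i ∈ Set.Ioc (0 : ℝ) 1},
        h ((fun i => (m i : ℝ)) + x)) (∫ x, h x) := by
  set s : (Fin d → ℤ) → Set (Fin d → ℝ) := fun m => {x | ∀ i, x i ∈ Set.Ioc (m i : ℝ) (m i + 1)}
  have hs : ∀ m x, x ∈ s m ↔ ∀ i, ⌈x i⌉ = m i + 1 := fun m x => by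
    simp only [s, Set.mem_ofPred_eq, Set.mem_Ioc, Int.ceil_eq_iff]
    push_cast
    simp
  have hmeas : ∀ m, MeasurableSet (s m) := fun m =>
    MeasurableSet.univ_pi' fun i => measurableSet_Ioc
  have hdisj : Pairwise (Function.onFun Disjoint s) := fun m n hmn => by
    refine Set.disjoint_left.2 fun x hx hy => hmn (funext fun i => ?_)
    have := ((hs m x).1 hx i).symm.trans ((hs n x).1 hy i)
    omega
  have huniv : ⋃ m, s m = Set.univ := Set.eq_univ_of_forall fun x =>
    Set.mem_iUnion.2 ⟨fun i => ⌈x i⌉ - 1, (hs _ x).2 fun i => by ring⟩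
  have H := hasSum_integral_iUnion hmeas hdisj hh.integrableOn
  rw [huniv, setIntegral_univ] at H
  refine H.congr_fun fun m => ?_
  have hpre : (fun x => (fun i => (m i : ℝ)) + x) ⁻¹' s m
      = {x : Fin d → ℝ | ∀ i, x i ∈ Set.Ioc (0 : ℝ) 1} := by
    ext x
    simp [s, add_comm (m _ : ℝ)]
  rw [← hpre]
  exact (measurePreserving_add_left volume _).setIntegral_preimage_emb
    (measurableEmbedding_addLeft _) h (s m)

/-- Mean squared deviation of the periodization of `g` from its mean. -/
theorem integral_sq_periodization_sub {d : ℕ} (g : (Fin d → ℝ) → ℝ) (hg : Continuous g)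
    (hs : HasCompactSupport g) :
    (∫ v in Set.univ.pi fun _ : Fin d => Set.Icc (0:ℝ) 1,
        ((∑' m : Fin d → ℤ, g ((fun i => (m i : ℝ)) + v)) - ∫ x, g x) ^ 2)
      = ∑' m : {m : Fin d → ℤ // m ≠ 0}, ‖lfourier d g (fun i => (m.1 i : ℝ))‖ ^ 2 := by
  set Q : Set (Fin d → ℝ) := {x | ∀ i, x i ∈ Set.Ioc (0 : ℝ) 1} with hQ
  have hQm : MeasurableSet Q := MeasurableSet.univ_pi' fun i => measurableSet_Ioc
  have hQae : (Set.univ.pi fun _ : Fin d => Set.Icc (0:ℝ) 1) =ᵐ[volume] Q := by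
    have : Q = Set.univ.pi fun _ : Fin d => Set.Ioc (0:ℝ) 1 := by ext; simp [hQ]
    rw [this]
    exact (Measure.pi_Ioc_ae_eq_pi_Icc (μ := fun _ : Fin d => (volume : Measure ℝ))).symm
  have hQfin : IsFiniteMeasure (volume.restrict Q) := by
    refine ⟨?_⟩
    rw [Measure.restrict_apply_univ, ← measure_congr hQae]
    exact (isCompact_univ_pi fun _ => isCompact_Icc).measure_lt_top
  have hQone : volume.real Q = 1 := by
    rw [measureReal_def, ← measure_congr hQae, volume_pi_pi]
    simp
  obtain ⟨R, hR⟩ := hs.isCompact.isBounded.exists_norm_le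
  set S : Finset (Fin d → ℤ) := Finset.Icc (fun _ => -(⌈R⌉ + 1)) (fun _ => ⌈R⌉ + 1)
  have hzero : ∀ x ∈ Q, ∀ m ∉ S, g ((fun i => (m i : ℝ)) + x) = 0 := by
    intro x hx m hm
    by_contra hne
    apply hm
    have hle := hR _ (subset_tsupport _ hne)
    have hi : ∀ i, |(m i : ℝ) + x i| ≤ R := fun i => (norm_le_pi_norm _ i).trans hle
    have hRc := Int.le_ceil R
    refine Finset.mem_Icc.2 ⟨fun i => ?_, fun i => ?_⟩ <;>
    · have h1 := abs_le.1 (hi i)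
      have h2 := hx i
      have h3 := h2.1
      have h4 := h2.2
      rify
      linarith
  set G : (Fin d → ℝ) → ℝ := fun x => ∑ m ∈ S, g ((fun i => (m i : ℝ)) + x) with hGdef
  have hGc : Continuous G := by fun_prop
  have hGt : ∀ x ∈ Q, ∑' m : Fin d → ℤ, g ((fun i => (m i : ℝ)) + x) = G x := fun x hx =>
    tsum_eq_sum fun m hm => hzero x hx m hm
  have hcont_int : ∀ {E : Type} [NormedAddCommGroup E] {h : (Fin d → ℝ) → E},
      Continuous h → IntegrableOn h Q := fun {E} _ {h} hh =>
    ((hh.continuousOn.integrableOn_compact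
      (isCompact_univ_pi fun _ => isCompact_Icc)).congr_set_ae hQae.symm)
  have hcoef : ∀ n : Fin d → ℤ,
      ∫ x in Q, UnitAddTorus.mFourier (-n) (fun i => (x i : UnitAddCircle)) * (G x : ℂ)
        = lfourier d g (fun i => (n i : ℝ)) := by
    intro n
    simp_rw [mFourier_neg_coe]
    set e : (Fin d → ℝ) → ℂ := fun x =>
      Complex.exp (-2 * (Real.pi : ℂ) * Complex.I * ((∑ i, x i * n i : ℝ) : ℂ))
    have hec : Continuous e := by fun_prop
    have hper : ∀ (m : Fin d → ℤ) x, e ((fun i => (m i : ℝ)) + x) = e x := by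
      intro m x
      refine Complex.exp_eq_exp_iff_exists_int.2 ⟨-∑ i, m i * n i, ?_⟩
      simp only [Pi.add_apply, add_mul, Finset.sum_add_distrib]
      push_cast
      ring
    have hI : Integrable fun x => (g x : ℂ) * e x :=
      ((Complex.continuous_ofReal.comp hg).mul hec).integrable_of_hasCompactSupport
        ((hs.comp_left (g := ((↑) : ℝ → ℂ)) Complex.ofReal_zero).mul_right)
    have H := hasSum_integral_unitCube_translates _ hI
    rw [lfourier, ← H.tsum_eq, tsum_eq_sum (s := S), ← integral_finsetSum]
    · refine integral_congr_ae (Filter.Eventually.of_forall fun x => ?_)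
      simp only [hGdef, hper, ← Finset.sum_mul]
      rw [Complex.ofReal_sum S, mul_comm]
    · intro m _
      exact hcont_int (by fun_prop)
    · intro m hm
      exact setIntegral_eq_zero_of_forall_eq_zero fun x hx => by simp [hzero x hx m hm]
  have hmean : ∫ x in Q, G x = ∫ x, g x := by
    have h := hcoef 0
    simp only [lfourier, neg_zero, UnitAddTorus.mFourier_zero] at h
    simpa [integral_complex_ofReal] using h
  have key := UnitAddTorus.hasSum_sq_norm_integral_mFourier_unitCube (fun x => (G x : ℂ))
    (by fun_prop)
  simp only [← hQ, hcoef, Complex.norm_real, Real.norm_eq_abs, sq_abs] at key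
  have hzero_coef : ‖lfourier d g (fun i => (((0 : Fin d → ℤ) i : ℤ) : ℝ))‖ ^ 2
      = (∫ x, g x) ^ 2 := by
    simp [lfourier, integral_complex_ofReal]
  have hsplit := key.summable.tsum_subtype_add_tsum_subtype_compl {(0 : Fin d → ℤ)}
  rw [key.tsum_eq, tsum_singleton (0 : Fin d → ℤ)
    (fun n : Fin d → ℤ => ‖lfourier d g (fun i => (n i : ℝ))‖ ^ 2), hzero_coef] at hsplit
  rw [setIntegral_congr_set hQae, setIntegral_congr_fun (g := fun x =>
    G x ^ 2 - (2 * (∫ x, g x) * G x - (∫ x, g x) ^ 2)) hQm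
    fun x hx => by simp only [hGt x hx]; ring]
  rw [integral_sub (hcont_int (by fun_prop)) (hcont_int (by fun_prop)),
    integral_sub (hcont_int (by fun_prop)) (hcont_int (by fun_prop)), integral_const_mul, hmean,
    setIntegral_const, hQone, ← hsplit]
  have hset : ∑' x : ↑({0}ᶜ : Set (Fin d → ℤ)), ‖lfourier d g (fun i => (x.1 i : ℝ))‖ ^ 2
      = ∑' m : {m : Fin d → ℤ // m ≠ 0}, ‖lfourier d g (fun i => (m.1 i : ℝ))‖ ^ 2 := rfl
  rw [hset, one_smul]
  ring

/-- The Fourier transform of a function precomposed with an inverse transpose. -/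
theorem lfourier_comp_inv_transpose {d : ℕ} (B : Matrix (Fin d) (Fin d) ℝ) (hB : IsUnit B.det)
    (f : (Fin d → ℝ) → ℝ) (hf : Continuous f) (y : Fin d → ℝ) :
    lfourier d (fun x => |B.det|⁻¹ * f ((B⁻¹)ᵀ.mulVec x)) y = lfourier d f (B.mulVec y) := by
  set h : (Fin d → ℝ) → ℂ := fun x => (f ((B⁻¹)ᵀ.mulVec x) : ℂ) *
    Complex.exp (-2 * (Real.pi : ℂ) * Complex.I * ((∑ i, x i * y i : ℝ) : ℂ)) with hh
  have hc : Continuous h := by fun_prop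
  have hmap := Real.map_matrix_volume_pi_eq_smul_volume_pi (M := Bᵀ)
    (by simpa using hB.ne_zero)
  have hlin : Continuous (Matrix.toLin' Bᵀ) := LinearMap.continuous_of_finiteDimensional _
  have hI := integral_map (μ := volume) hlin.aemeasurable
    (hc.aestronglyMeasurable (μ := volume.map (Matrix.toLin' Bᵀ)))
  rw [hmap, integral_smul_measure, ENNReal.toReal_ofReal (abs_nonneg _), Matrix.det_transpose,
    abs_inv] at hI
  have hl : lfourier d (fun x => |B.det|⁻¹ * f ((B⁻¹)ᵀ.mulVec x)) y = |B.det|⁻¹ • ∫ x, h x := by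
    rw [← integral_smul]
    refine integral_congr_ae (Filter.Eventually.of_forall fun x => ?_)
    simp only [hh, Complex.real_smul]
    push_cast
    ring
  rw [hl, hI]
  refine integral_congr_ae (Filter.Eventually.of_forall fun x => ?_)
  have hdot : ∑ i, (Bᵀ.mulVec x) i * y i = ∑ i, x i * (B.mulVec y) i := by
    change Bᵀ.mulVec x ⬝ᵥ y = x ⬝ᵥ B.mulVec y
    rw [Matrix.mulVec_transpose, Matrix.dotProduct_mulVec]
  simp only [hh, Matrix.toLin'_apply, hdot]
  rw [Matrix.mulVec_mulVec, ← Matrix.transpose_mul, Matrix.mul_nonsing_inv B hB]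
  simp

/-- For an invertible matrix `B`, a shift `v` uniformly distributed on `[0,1]^d`, and
a continuous compactly supported `f`, the mean squared integration error of the
randomly shifted lattice rule equals `∑_{m ≠ 0} |ℱf(Bm)|²`. -/
theorem stmt_15 (d : ℕ) (hd : 1 ≤ d) (B : Matrix (Fin d) (Fin d) ℝ) (hB : IsUnit B)
    (f : (Fin d → ℝ) → ℝ) (hf : Continuous f) (hsupp : HasCompactSupport f) :
    (∫ v in Set.univ.pi fun _ : Fin d => Set.Icc (0:ℝ) 1,
        (frolovQ d B v f - ∫ x, f x) ^ 2)
      = ∑' m : {m : Fin d → ℤ // m ≠ 0},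
          ‖lfourier d f (B.mulVec fun i => (m.1 i : ℝ))‖ ^ 2 := by
  
  have hdet : IsUnit B.det := (Matrix.isUnit_iff_isUnit_det B).1 hB
  have hdet' : B.det ≠ 0 := hdet.ne_zero
  set g : (Fin d → ℝ) → ℝ := fun x => |B.det|⁻¹ * f ((B⁻¹)ᵀ.mulVec x) with hg
  have hgc : Continuous g := by fun_prop
  have hgs : HasCompactSupport g := by
    refine HasCompactSupport.of_support_subset_isCompact
      (hsupp.isCompact.image (f := fun x => Bᵀ.mulVec x) (by fun_prop)) fun x hx => ?_
    refine ⟨(B⁻¹)ᵀ.mulVec x, subset_tsupport _ (right_ne_zero_of_mul hx), ?_⟩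
    simp [Matrix.mulVec_mulVec, ← Matrix.transpose_mul, Matrix.nonsing_inv_mul B hdet]
  have hint : ∫ x, g x = ∫ x, f x := by
    have h := lfourier_comp_inv_transpose B hdet f hf 0
    simp only [lfourier, Matrix.mulVec_zero, Pi.zero_apply, mul_zero, Finset.sum_const_zero,
      Complex.ofReal_zero, Complex.exp_zero, mul_one, integral_complex_ofReal] at h
    exact Complex.ofReal_injective h
  have hQ : ∀ v, frolovQ d B v f = ∑' m : Fin d → ℤ, g ((fun i => (m i : ℝ)) + v) := fun v => by
    rw [frolovQ, ← tsum_mul_left]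
  simp_rw [hQ, ← hint, integral_sq_periodization_sub g hgc hgs, hg,
    lfourier_comp_inv_transpose B hdet f hf]
end

section
/- For any invertible B ∈ ℝ^(d×d), v ∈ ℝ^d, and continuous compactly supported f : ℝ^d → ℝ, the integration error satisfies |Q_B^v(f) − ∫_{ℝ^d} f(x)dx| ≤ ∑_{m∈ℤ^d \ {0}} |ℱf(Bm)|. -/
open Matrix MeasureTheory

open Complex in
theorem mFourier_coe_apply {ι : Type*} [Fintype ι] (n : ι → ℤ) (x : ι → ℝ) :
    UnitAddTorus.mFourier n (fun i => (x i : UnitAddCircle)) =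
      exp (2 * Real.pi * I * ((∑ i, n i * x i : ℝ) : ℂ)) := by
  simp only [UnitAddTorus.mFourier, ContinuousMap.coe_mk, fourier_coe_apply, ← Complex.exp_sum]
  congr 1
  push_cast
  rw [Finset.mul_sum]
  exact Finset.sum_congr rfl fun i _ => by ring

section Periodization

variable {ι : Type*} [Fintype ι] {g : (ι → ℝ) → ℂ}

theorem finite_translates_ne_zero (hs : HasCompactSupport g) (R : ℝ) :
    {m : ι → ℤ | ∃ x : ι → ℝ, ‖x‖ ≤ R ∧ g ((fun i => (m i : ℝ)) + x) ≠ 0}.Finite := by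
  classical
  obtain ⟨C, hC⟩ := hs.isCompact.isBounded.exists_norm_le
  refine (Set.finite_Icc (fun _ : ι => -⌈C + R⌉) (fun _ : ι => ⌈C + R⌉)).subset ?_
  rintro m ⟨x, hx, hg⟩
  have hbound (i : ι) : |(m i : ℝ)| ≤ C + R := by
    have h1 := (norm_le_pi_norm _ i).trans (hC _ (subset_tsupport g hg))
    have h2 := (norm_le_pi_norm x i).trans hx
    simp only [Pi.add_apply, Real.norm_eq_abs, abs_le] at h1 h2
    exact abs_le.2 ⟨by linarith, by linarith⟩
  have hceil := Int.le_ceil (C + R)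
  refine ⟨fun i => ?_, fun i => ?_⟩
  · have := (abs_le.1 (hbound i)).1
    exact_mod_cast (by push_cast; linarith : ((-⌈C + R⌉ : ℤ) : ℝ) ≤ m i)
  · exact_mod_cast ((abs_le.1 (hbound i)).2.trans hceil)

theorem exists_finset_periodization_eq_sum (hs : HasCompactSupport g) (R : ℝ) :
    ∃ s : Finset (ι → ℤ), (∀ x : ι → ℝ, ‖x‖ ≤ R → ∀ m ∉ s, g ((fun i => (m i : ℝ)) + x) = 0) ∧
      ∀ x : ι → ℝ, ‖x‖ ≤ R →
        ∑' m : ι → ℤ, g ((fun i => (m i : ℝ)) + x) = ∑ m ∈ s, g ((fun i => (m i : ℝ)) + x) := by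
  have hzero : ∀ x : ι → ℝ, ‖x‖ ≤ R → ∀ m ∉ (finite_translates_ne_zero hs R).toFinset,
      g ((fun i => (m i : ℝ)) + x) = 0 := by
    intro x hx m hm
    by_contra h
    exact hm ((Set.Finite.mem_toFinset _).2 ⟨x, hx, h⟩)
  exact ⟨_, hzero, fun x hx => tsum_eq_sum (hzero x hx)⟩

theorem continuous_periodization (hc : Continuous g) (hs : HasCompactSupport g) :
    Continuous fun x : ι → ℝ => ∑' m : ι → ℤ, g ((fun i => (m i : ℝ)) + x) := by
  refine continuous_iff_continuousAt.2 fun x => ?_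
  obtain ⟨s, -, hsum⟩ := exists_finset_periodization_eq_sum hs (‖x‖ + 1)
  have hfin : Continuous fun x : ι → ℝ => ∑ m ∈ s, g ((fun i => (m i : ℝ)) + x) := by fun_prop
  refine hfin.continuousAt.congr ?_
  have hnear : ∀ᶠ y in nhds x, ‖y‖ < ‖x‖ + 1 :=
    continuous_norm.continuousAt.eventually_lt continuousAt_const (by simp)
  filter_upwards [hnear] with y hy using (hsum y hy.le).symm

omit [Fintype ι] in
theorem isOpenQuotientMap_coe_unitAddTorus :
    IsOpenQuotientMap fun (x : ι → ℝ) => (fun i => (x i : UnitAddCircle) : UnitAddTorus ι) :=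
  IsOpenQuotientMap.piMap fun _ => QuotientAddGroup.isOpenQuotientMap_mk

omit [Fintype ι] in
theorem periodization_eq_of_coe_eq {x y : ι → ℝ}
    (h : (fun i => (x i : UnitAddCircle)) = fun i => (y i : UnitAddCircle)) :
    ∑' m : ι → ℤ, g ((fun i => (m i : ℝ)) + x) = ∑' m : ι → ℤ, g ((fun i => (m i : ℝ)) + y) := by
  have hint (i : ι) : ∃ k : ℤ, x i = y i + k := by
    have hsub : ((x i - y i : ℝ) : UnitAddCircle) = 0 := by
      rw [AddCircle.coe_sub, sub_eq_zero]
      exact congrFun h i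
    obtain ⟨k, hk⟩ := (AddCircle.coe_eq_zero_iff 1).1 hsub
    exact ⟨k, by rw [zsmul_one] at hk; linarith⟩
  choose k hk using hint
  rw [← (Equiv.addRight k).tsum_eq (fun m : ι → ℤ => g ((fun i => (m i : ℝ)) + y))]
  refine tsum_congr fun m => congrArg g (funext fun i => ?_)
  simp only [Pi.add_apply, hk, Equiv.coe_addRight, Int.cast_add]
  ring

theorem exists_continuousMap_unitAddTorus_eq_periodization
    (hc : Continuous g) (hs : HasCompactSupport g) :
    ∃ G : C(UnitAddTorus ι, ℂ), ∀ x : ι → ℝ,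
      G (fun i => (x i : UnitAddCircle)) = ∑' m : ι → ℤ, g ((fun i => (m i : ℝ)) + x) := by
  let q : C(ι → ℝ, UnitAddTorus ι) :=
    ⟨fun x i => (x i : UnitAddCircle), isOpenQuotientMap_coe_unitAddTorus.continuous⟩
  have hq : Topology.IsQuotientMap q := isOpenQuotientMap_coe_unitAddTorus.isQuotientMap
  let F : C(ι → ℝ, ℂ) := ⟨_, continuous_periodization hc hs⟩
  have hF : Function.FactorsThrough F q := fun _ _ h => periodization_eq_of_coe_eq h
  exact ⟨hq.lift F hF, fun x => DFunLike.congr_fun (hq.lift_comp F hF) x⟩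

theorem integral_eq_setIntegral_periodization (hc : Continuous g) (hs : HasCompactSupport g) :
    ∫ x, g x = ∫ x in {x : ι → ℝ | ∀ i, x i ∈ Set.Ioc (0 : ℝ) (0 + 1)},
      ∑' m : ι → ℤ, g ((fun i => (m i : ℝ)) + x) := by
  set D : Set (ι → ℝ) := {x | ∀ i, x i ∈ Set.Ioc (0 : ℝ) (0 + 1)}
  have hD : MeasurableSet D := MeasurableSet.univ_pi' fun _ => measurableSet_Ioc
  have hnorm : ∀ x ∈ D, ‖x‖ ≤ 1 := fun x hx =>
    (pi_norm_le_iff_of_nonneg zero_le_one).2 fun i => by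
      rw [Real.norm_eq_abs, abs_of_pos (hx i).1]; simpa using (hx i).2
  obtain ⟨s, hzero, hsum⟩ := exists_finset_periodization_eq_sum hs 1
  have hint (m : ι → ℤ) : Integrable fun x : ι → ℝ => g ((fun i => (m i : ℝ)) + x) :=
    (hc.integrable_of_hasCompactSupport hs).comp_add_left _
  let S (m : ι → ℤ) : Set (ι → ℝ) := {x | ∀ i, x i ∈ Set.Ioc (m i : ℝ) (m i + 1)}
  have hS (m : ι → ℤ) : MeasurableSet (S m) := MeasurableSet.univ_pi' fun _ => measurableSet_Ioc
  have hdisj : Pairwise (Function.onFun Disjoint S) := by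
    intro m n hmn
    refine Set.disjoint_left.2 fun x hx hy => hmn (funext fun i => ?_)
    have hm := hx i
    have hn := hy i
    have h1 : (m i : ℝ) < n i + 1 := hm.1.trans_le hn.2
    have h2 : (n i : ℝ) < m i + 1 := hn.1.trans_le hm.2
    norm_cast at h1 h2
    lia
  have hunion : ⋃ m, S m = Set.univ := by
    refine Set.eq_univ_of_forall fun x => Set.mem_iUnion.2 ⟨fun i => ⌈x i⌉ - 1, fun i => ?_⟩
    have h1 := Int.ceil_lt_add_one (x i)
    have h2 := Int.le_ceil (x i)
    push_cast
    exact ⟨by linarith, by linarith⟩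
  have htrans (m : ι → ℤ) : ∫ x in S m, g x = ∫ x in D, g ((fun i => (m i : ℝ)) + x) := by
    rw [← (measurePreserving_add_left volume fun i => (m i : ℝ)).setIntegral_preimage_emb
      (measurableEmbedding_addLeft _) g (S m)]
    congr 2
    ext x
    simp [S, D]
  calc ∫ x, g x = ∑' m, ∫ x in S m, g x := by
        rw [← integral_iUnion hS hdisj, hunion, setIntegral_univ]
        exact (hc.integrable_of_hasCompactSupport hs).integrableOn
    _ = ∑' m : ι → ℤ, ∫ x in D, g ((fun i => (m i : ℝ)) + x) := tsum_congr htrans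
    _ = ∑ m ∈ s, ∫ x in D, g ((fun i => (m i : ℝ)) + x) :=
        tsum_eq_sum fun m hm => setIntegral_eq_zero_of_forall_eq_zero fun x hx =>
          hzero x (hnorm x hx) m hm
    _ = ∫ x in D, ∑ m ∈ s, g ((fun i => (m i : ℝ)) + x) :=
        (integral_finsetSum _ fun m _ => (hint m).integrableOn).symm
    _ = _ := setIntegral_congr_fun hD fun x hx => (hsum x (hnorm x hx)).symm

theorem mFourierCoeff_periodization (hc : Continuous g) (hs : HasCompactSupport g)
    {G : UnitAddTorus ι → ℂ}
    (hG : ∀ x : ι → ℝ, G (fun i => (x i : UnitAddCircle)) =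
      ∑' m : ι → ℤ, g ((fun i => (m i : ℝ)) + x)) (n : ι → ℤ) :
    UnitAddTorus.mFourierCoeff G n =
      ∫ x, UnitAddTorus.mFourier (-n) (fun i => (x i : UnitAddCircle)) * g x := by
  have he : Continuous fun x : ι → ℝ =>
      UnitAddTorus.mFourier (-n) (fun i => (x i : UnitAddCircle)) :=
    (ContinuousMap.continuous _).comp isOpenQuotientMap_coe_unitAddTorus.continuous
  rw [UnitAddTorus.mFourierCoeff_eq_integral G n fun _ => 0,
    integral_eq_setIntegral_periodization
      (g := fun x => UnitAddTorus.mFourier (-n) (fun i => (x i : UnitAddCircle)) * g x)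
      (he.mul hc) hs.mul_left]
  congr 1
  ext x
  rw [hG, smul_eq_mul, ← tsum_mul_left]
  refine tsum_congr fun m => ?_
  congr 2
  ext i
  simp

/-- **Poisson summation** for the lattice of integer points. -/
theorem hasSum_fourier_periodization (hc : Continuous g) (hs : HasCompactSupport g)
    (hsum : Summable fun n : ι → ℤ =>
      ∫ x, UnitAddTorus.mFourier (-n) (fun i => (x i : UnitAddCircle)) * g x) (v : ι → ℝ) :
    HasSum (fun n : ι → ℤ =>
      (∫ x, UnitAddTorus.mFourier (-n) (fun i => (x i : UnitAddCircle)) * g x) *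
        UnitAddTorus.mFourier n (fun i => (v i : UnitAddCircle)))
      (∑' m : ι → ℤ, g ((fun i => (m i : ℝ)) + v)) := by
  obtain ⟨G, hG⟩ := exists_continuousMap_unitAddTorus_eq_periodization hc hs
  have hcoeff := funext (mFourierCoeff_periodization hc hs hG)
  rw [← hcoeff] at hsum
  simpa only [hG, hcoeff, smul_eq_mul] using
    UnitAddTorus.hasSum_mFourier_series_apply_of_summable hsum fun i => (v i : UnitAddCircle)

end Periodization

theorem integral_comp_mulVec {ι E : Type*} [Fintype ι] [DecidableEq ι] [NormedAddCommGroup E]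
    [NormedSpace ℝ E] {A : Matrix ι ι ℝ} (hA : A.det ≠ 0) {h : (ι → ℝ) → E} (hh : Continuous h) :
    ∫ x, h (A *ᵥ x) = |A.det|⁻¹ • ∫ x, h x := by
  have hmeas : AEMeasurable (fun x => A *ᵥ x) (volume : Measure (ι → ℝ)) :=
    (Continuous.matrix_mulVec continuous_const continuous_id).aemeasurable
  have hmap : Measure.map (fun x => A *ᵥ x) volume = _ :=
    Real.map_matrix_volume_pi_eq_smul_volume_pi hA
  rw [← integral_map hmeas hh.aestronglyMeasurable, hmap, integral_smul_measure,
    ENNReal.toReal_ofReal (abs_nonneg _), abs_inv]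

theorem integral_mFourier_mul_comp_mulVec {d : ℕ} {B : Matrix (Fin d) (Fin d) ℝ}
    (hB : IsUnit B) {f : (Fin d → ℝ) → ℝ} (hf : Continuous f) (n : Fin d → ℤ) :
    ∫ x, UnitAddTorus.mFourier (-n) (fun i => (x i : UnitAddCircle)) *
        (f ((B⁻¹)ᵀ *ᵥ x) : ℂ) =
      |B.det| * lfourier d f (B *ᵥ fun i => (n i : ℝ)) := by
  have hdet : IsUnit B.det := (Matrix.isUnit_iff_isUnit_det B).1 hB
  have hA : ((B⁻¹)ᵀ).det = B.det⁻¹ := by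
    rw [Matrix.det_transpose, Matrix.det_nonsing_inv, Ring.inverse_eq_inv']
  have hphase (x : Fin d → ℝ) :
      ∑ i, ((B⁻¹)ᵀ *ᵥ x) i * (B *ᵥ fun i => (n i : ℝ)) i = ∑ i, n i * x i := by
    change ((B⁻¹)ᵀ *ᵥ x) ⬝ᵥ (B *ᵥ fun i => (n i : ℝ)) = (fun i => (n i : ℝ)) ⬝ᵥ x
    rw [Matrix.dotProduct_mulVec, ← Matrix.mulVec_transpose, Matrix.mulVec_mulVec,
      ← Matrix.transpose_mul, Matrix.nonsing_inv_mul _ hdet, Matrix.transpose_one,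
      Matrix.one_mulVec, dotProduct_comm]
  have hchange := integral_comp_mulVec (A := (B⁻¹)ᵀ) (by simpa [hA] using hdet.ne_zero)
    (h := fun x => (f x : ℂ) * Complex.exp (-2 * (Real.pi : ℂ) * Complex.I *
      ((∑ i, x i * (B *ᵥ fun i => (n i : ℝ)) i : ℝ) : ℂ))) (by fun_prop)
  rw [hA, abs_inv, inv_inv, Complex.real_smul] at hchange
  rw [lfourier, ← hchange]
  congr 1
  ext x
  rw [hphase, mFourier_coe_apply, mul_comm]
  congr 2
  simp

/-- For any invertible `B`, shift `v` and continuous compactly supported `f`, the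
integration error of the shifted lattice rule is bounded by `∑_{m ≠ 0} |ℱf(Bm)|`
(an inequality in `[0,∞]`, vacuous if the right-hand side is infinite). -/
theorem stmt_16 (d : ℕ) (hd : 1 ≤ d) (B : Matrix (Fin d) (Fin d) ℝ) (hB : IsUnit B)
    (v : Fin d → ℝ) (f : (Fin d → ℝ) → ℝ) (hf : Continuous f)
    (hsupp : HasCompactSupport f) :
    ENNReal.ofReal |frolovQ d B v f - ∫ x, f x|
      ≤ ∑' m : {m : Fin d → ℤ // m ≠ 0},
          ENNReal.ofReal ‖lfourier d f (B.mulVec fun i => (m.1 i : ℝ))‖ := by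
  have hdet : IsUnit B.det := (Matrix.isUnit_iff_isUnit_det B).1 hB
  have hdet' : ((|B.det| : ℝ) : ℂ) ≠ 0 := by simpa using hdet.ne_zero
  set c : (Fin d → ℤ) → ℂ := fun m => lfourier d f (B *ᵥ fun i => (m i : ℝ))
  change _ ≤ ∑' m : {m : Fin d → ℤ // m ≠ 0}, ENNReal.ofReal ‖c m.1‖
  by_cases htop : ∑' m : {m : Fin d → ℤ // m ≠ 0}, ENNReal.ofReal ‖c m.1‖ = ⊤
  · exact htop ▸ le_top
  have hnorm : Summable fun m : {m : Fin d → ℤ // m ≠ 0} => ‖c m.1‖ := by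
    simpa [ENNReal.toReal_ofReal] using ENNReal.summable_toReal htop
  have hsum : Summable c :=
    (Set.finite_singleton (0 : Fin d → ℤ)).summable_compl_iff.1 hnorm.of_norm
  let g : (Fin d → ℝ) → ℂ := fun x => (f ((B⁻¹)ᵀ *ᵥ x) : ℂ)
  have hg : Continuous g := by fun_prop
  have hgs : HasCompactSupport g := by
    refine HasCompactSupport.intro (hsupp.isCompact.image
      (Continuous.matrix_mulVec continuous_const continuous_id : Continuous (Bᵀ *ᵥ ·)))
      fun x hx => ?_
    by_contra hgx
    refine hx ⟨(B⁻¹)ᵀ *ᵥ x, subset_tsupport f fun hfx => hgx (by simp [g, hfx]), ?_⟩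
    change Bᵀ *ᵥ ((B⁻¹)ᵀ *ᵥ x) = x
    rw [Matrix.mulVec_mulVec, ← Matrix.transpose_mul, Matrix.nonsing_inv_mul _ hdet,
      Matrix.transpose_one, Matrix.one_mulVec]
  have hcoeff (n : Fin d → ℤ) :
      ∫ x, UnitAddTorus.mFourier (-n) (fun i => (x i : UnitAddCircle)) * g x = |B.det| * c n :=
    integral_mFourier_mul_comp_mulVec hB hf n
  have hpoisson := hasSum_fourier_periodization hg hgs
    (by simpa only [hcoeff] using hsum.mul_left _) v
  simp only [hcoeff] at hpoisson
  set e : (Fin d → ℤ) → ℂ := fun n => UnitAddTorus.mFourier n (fun i => (v i : UnitAddCircle))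
  have hQ : HasSum (fun n => c n * e n) (frolovQ d B v f : ℂ) := by
    have hscaled := hpoisson.mul_left ((|B.det| : ℝ) : ℂ)⁻¹
    simp only [mul_assoc, inv_mul_cancel_left₀ hdet'] at hscaled
    rw [frolovQ, Complex.ofReal_mul, Complex.ofReal_inv, Complex.ofReal_tsum]
    exact hscaled
  have hzero : c 0 * e 0 = ((∫ x, f x : ℝ) : ℂ) := by
    simp only [c, e, lfourier, UnitAddTorus.mFourier_zero]
    simp [integral_complex_ofReal, Matrix.mulVec, dotProduct]
  have herr : ((frolovQ d B v f - ∫ x, f x : ℝ) : ℂ) =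
      ∑' m : {m : Fin d → ℤ // m ≠ 0}, c m.1 * e m.1 := by
    have hsplit := hQ.summable.tsum_subtype_add_tsum_subtype_compl {(0 : Fin d → ℤ)}
    rw [tsum_singleton (0 : Fin d → ℤ) fun n => c n * e n, hQ.tsum_eq, hzero] at hsplit
    rw [Complex.ofReal_sub, ← hsplit, add_sub_cancel_left]
    rfl
  have he (n : Fin d → ℤ) : ‖c n * e n‖ = ‖c n‖ := by
    simp only [e, UnitAddTorus.mFourier, fourier_apply, ContinuousMap.coe_mk, norm_mul, norm_prod,
      Circle.norm_coe, Finset.prod_const_one, mul_one]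
  rw [← Real.norm_eq_abs, ← Complex.norm_real, herr, ← ENNReal.ofReal_tsum_of_nonneg
    (fun _ => norm_nonneg _) hnorm]
  refine ENNReal.ofReal_le_ofReal ((norm_tsum_le_tsum_norm ?_).trans_eq ?_)
  · simpa only [he] using hnorm
  · simp only [he]
end
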